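/- arXiv:1610.05051 — 2 statements merged into one kernel-verified Lean document; each statement's English description precedes it below -/
import Mathlib

section
/- The system matrix and the coefficient matrix satisfy the intertwining relation L * Ẑ = Ẑ * C as J×K real matrices; equivalently, for every vector y ∈ ℝ^K, L (Ẑ y) = Ẑ (C y). -/
open Matrix BigOperators

/-- The connection matrix `L_k` associated to a face between cells `j₁` and `j₂`,
with nonnegative coefficients `a`, `b`. -/
noncomputable def connMat {J : ℕ} (j₁ j₂ : Fin J) (a b : ℝ) : Matrix (Fin J) (Fin J) ℝ :=
  Matrix.of fun i j =>
    if i = j₁ ∧ j = j₁ then -a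
    else if i = j₁ ∧ j = j₂ then b
    else if i = j₂ ∧ j = j₁ then a
    else if i = j₂ ∧ j = j₂ then -b
    else 0

/-- The direction vector `ẑ_k` associated to a face between cells `j₁` and `j₂`. -/
noncomputable def dirVec {J : ℕ} (j₁ j₂ : Fin J) : Fin J → ℝ :=
  fun j => if j = j₁ then 1 else if j = j₂ then -1 else 0

/-- The matrix `Ẑ` whose `k`-th column is the direction vector `ẑ_k`. -/
noncomputable def ZhatMat {J K : ℕ} (j₁ j₂ : Fin K → Fin J) : Matrix (Fin J) (Fin K) ℝ :=
  Matrix.of fun j k => dirVec (j₁ k) (j₂ k) j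

/-- The coefficient matrix `C` with entries `C_{i,l} = b_i (ẑ_l)_{j₂ i} - a_i (ẑ_l)_{j₁ i}`,
so that `L_i ẑ_l = C_{i,l} • ẑ_i`. -/
noncomputable def coeffMat {J K : ℕ} (j₁ j₂ : Fin K → Fin J) (a b : Fin K → ℝ) :
    Matrix (Fin K) (Fin K) ℝ :=
  Matrix.of fun i l => b i * dirVec (j₁ l) (j₂ l) (j₂ i) - a i * dirVec (j₁ l) (j₂ l) (j₁ i)

/-- The flux vector `f₀` with entries `(f₀)_k = b_k (m₀)_{j₂ k} - a_k (m₀)_{j₁ k}`,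
so that `L_k m₀ = (f₀)_k • ẑ_k`. -/
noncomputable def fluxVec {J K : ℕ} (j₁ j₂ : Fin K → Fin J) (a b : Fin K → ℝ)
    (m₀ : Fin J → ℝ) : Fin K → ℝ :=
  fun k => b k * m₀ (j₂ k) - a k * m₀ (j₁ k)

/-- The connection matrix is the outer product of the direction vector with the flux functional. -/
theorem connMat_apply {J : ℕ} {j₁ j₂ : Fin J} (h : j₁ ≠ j₂) (a b : ℝ) (i j : Fin J) :
    connMat j₁ j₂ a b i j =
      dirVec j₁ j₂ i * ((if j = j₂ then b else 0) - (if j = j₁ then a else 0)) := by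
  simp only [connMat, dirVec, Matrix.of_apply]
  split_ifs <;> simp_all

/-- The connection matrix maps every vector to a multiple of the direction vector. -/
theorem connMat_mulVec {J : ℕ} {j₁ j₂ : Fin J} (h : j₁ ≠ j₂) (a b : ℝ) (v : Fin J → ℝ) :
    connMat j₁ j₂ a b *ᵥ v = (b * v j₂ - a * v j₁) • dirVec j₁ j₂ := by
  ext i
  simp only [Matrix.mulVec, dotProduct, connMat_apply h, mul_assoc, ← Finset.mul_sum,
    sub_mul, ite_mul, zero_mul, Finset.sum_sub_distrib, Finset.sum_ite_eq',
    Finset.mem_univ, if_true, Pi.smul_apply, smul_eq_mul]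
  ring

/-- The intertwining relation `L * Ẑ = Ẑ * C`; equivalently, for every
`y ∈ ℝ^K`, `L (Ẑ y) = Ẑ (C y)`. -/
theorem stmt6 (J K : ℕ) (hJ : 0 < J) (hK : 0 < K)
    (j₁ j₂ : Fin K → Fin J) (hne : ∀ k, j₁ k ≠ j₂ k)
    (a b : Fin K → ℝ) (ha : ∀ k, 0 ≤ a k) (hb : ∀ k, 0 ≤ b k)
    (L : Matrix (Fin J) (Fin J) ℝ)
    (hL : L = ∑ k : Fin K, connMat (j₁ k) (j₂ k) (a k) (b k)) :
    L * ZhatMat j₁ j₂ = ZhatMat j₁ j₂ * coeffMat j₁ j₂ a b ∧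
    ∀ y : Fin K → ℝ,
      L.mulVec ((ZhatMat j₁ j₂).mulVec y)
        = (ZhatMat j₁ j₂).mulVec ((coeffMat j₁ j₂ a b).mulVec y) := by
  have h : L * ZhatMat j₁ j₂ = ZhatMat j₁ j₂ * coeffMat j₁ j₂ a b := by
    ext i l
    rw [hL, Matrix.sum_mul, Matrix.sum_apply, Matrix.mul_apply]
    refine Finset.sum_congr rfl fun k _ => ?_
    have hk := congrFun
      (connMat_mulVec (hne k) (a k) (b k) (dirVec (j₁ l) (j₂ l))) i
    rw [Pi.smul_apply, smul_eq_mul, mul_comm] at hk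
    exact hk
  exact ⟨h, fun y => by rw [Matrix.mulVec_mulVec, Matrix.mulVec_mulVec, h]⟩
end

section
/- The function x : ℝ → ℝ^K defined by x(t) = (∑'_{i ≥ 1} (t^i / i!) • C^{i−1}) f₀ satisfies x(0) = 0 and solves the linear inhomogeneous ODE x'(t) = C x(t) + f₀ for every t ∈ ℝ (i.e., x has derivative C x(t) + f₀ at every t). -/
open Matrix BigOperators

section BanachAlgebra

variable {A : Type*} [NormedRing A] [NormedAlgebra ℝ A] [CompleteSpace A]

/-- In a real Banach algebra, `t ↦ ∑ i, (t ^ (i + 1) / (i + 1)!) • a ^ i`, which is `t φ₁(t a)`,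
has derivative `a * (t φ₁(t a)) + 1`. -/
theorem hasDerivAt_tsum_pow_succ_div_factorial_smul_pow (a : A) (t : ℝ) :
    HasDerivAt (fun s : ℝ => ∑' i : ℕ, (s ^ (i + 1) / (Nat.factorial (i + 1) : ℝ)) • a ^ i)
      (a * (∑' i : ℕ, (t ^ (i + 1) / (Nat.factorial (i + 1) : ℝ)) • a ^ i) + 1) t := by
  set R : ℝ := |t| + 1
  have hbound : Summable fun n : ℕ => ‖((Nat.factorial n : ℝ)⁻¹) • (R • a) ^ n‖ :=
    NormedSpace.norm_expSeries_summable' (𝕂 := ℝ) (R • a)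
  have hterm (n : ℕ) (s : ℝ) :
      HasDerivAt (fun s : ℝ => (s ^ (n + 1) / (Nat.factorial (n + 1) : ℝ)) • a ^ n)
        (((Nat.factorial n : ℝ)⁻¹) • (s • a) ^ n) s := by
    convert! ((hasDerivAt_pow (n + 1) s).div_const
      (Nat.factorial (n + 1) : ℝ)).smul_const (a ^ n) using 1
    rw [smul_pow, smul_smul, Nat.factorial_succ]
    congr 1
    push_cast
    field_simp
  have hle (n : ℕ) (s : ℝ) (hs : s ∈ Metric.ball (0 : ℝ) R) :
      ‖((Nat.factorial n : ℝ)⁻¹) • (s • a) ^ n‖ ≤ ‖((Nat.factorial n : ℝ)⁻¹) • (R • a) ^ n‖ := by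
    have hsR : |s| ≤ |R| := by
      have : |s| < R := by simpa using hs
      exact this.le.trans (le_abs_self R)
    simp only [smul_pow, norm_smul, norm_pow, Real.norm_eq_abs]
    gcongr
  have hR : (0 : ℝ) < R := by positivity
  have ht : t ∈ Metric.ball (0 : ℝ) R := by simp [R]
  have hzero : (0 : ℝ) ∈ Metric.ball (0 : ℝ) R := Metric.mem_ball_self hR
  have hpre := (convex_ball (0 : ℝ) R).isPreconnected
  have hsummable_zero : Summable fun i : ℕ =>
      ((0 : ℝ) ^ (i + 1) / (Nat.factorial (i + 1) : ℝ)) • a ^ i := by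
    simp
  have hsummable := summable_of_summable_hasDerivAt_of_isPreconnected hbound Metric.isOpen_ball
    hpre (fun n s _ => hterm n s) hle hzero hsummable_zero ht
  convert! hasDerivAt_tsum_of_isPreconnected hbound Metric.isOpen_ball
    hpre (fun n s _ => hterm n s) hle hzero hsummable_zero ht using 1
  rw [(NormedSpace.expSeries_summable' (𝕂 := ℝ) (t • a)).tsum_eq_zero_add,
    ← hsummable.tsum_mul_left, add_comm]
  congr 1
  · simp
  · refine tsum_congr fun n => ?_
    rw [smul_pow, smul_smul, mul_smul_comm, ← pow_succ', div_eq_inv_mul]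

end BanachAlgebra

/-- The function `x(t) = (∑'_{i ≥ 1} (t^i / i!) • C^(i-1)) f₀` (written here with
the index shift `i ↦ i + 1`) satisfies `x(0) = 0` and solves `x'(t) = C x(t) + f₀` for all `t`. -/
theorem stmt9 (K : ℕ) (hK : 0 < K)
    (C : Matrix (Fin K) (Fin K) ℝ) (f₀ : Fin K → ℝ)
    (x : ℝ → (Fin K → ℝ))
    (hx : ∀ t : ℝ, x t =
      (∑' i : ℕ, (t ^ (i + 1) / (Nat.factorial (i + 1) : ℝ)) • C ^ i).mulVec f₀) :
    x 0 = 0 ∧ ∀ t : ℝ, HasDerivAt x (C.mulVec (x t) + f₀) t := by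
  refine ⟨by simp [hx], fun t => ?_⟩
  let : NormedRing (Matrix (Fin K) (Fin K) ℝ) := Matrix.linftyOpNormedRing
  let : NormedAlgebra ℝ (Matrix (Fin K) (Fin K) ℝ) := Matrix.linftyOpNormedAlgebra
  let applyVec : Matrix (Fin K) (Fin K) ℝ →L[ℝ] (Fin K → ℝ) :=
    LinearMap.toContinuousLinearMap ((Matrix.mulVecBilin ℝ ℝ).flip f₀)
  have h := applyVec.hasFDerivAt.comp_hasDerivAt t
    (hasDerivAt_tsum_pow_succ_div_factorial_smul_pow C t)
  have hderiv : C.mulVec (x t) + f₀ = applyVec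
      (C * (∑' i : ℕ, (t ^ (i + 1) / (Nat.factorial (i + 1) : ℝ)) • C ^ i) + 1) := by
    change _ = (C * _ + 1).mulVec f₀
    rw [Matrix.add_mulVec, Matrix.one_mulVec, ← Matrix.mulVec_mulVec, hx]
  rw [hderiv, funext hx]
  exact h
end
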